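/- arXiv:2510.14388 — 4 statements merged into one kernel-verified Lean document; each statement's English description precedes it below -/
import Mathlib

section
/- For a deterministic MDP with finite nonempty state type S, finite nonempty action type A, transition T, reward r, and discount γ with 0 ≤ γ ≤ 1: if a nonstationary policy π = (π₀,…,π_{n−1}) with π_k : S → A is recursively greedy, i.e. for every k < n and every state s the action π_k(s) maximizes a ↦ r(s,a) + γ V_{n−k−1}^*(T(s,a)) over A, then the action sequence generated by following π from any initial state s₀ (taking a_k = π_k(s_k)) has discounted return Ret(s₀, a) = V_n^*(s₀); that is, a recursively optimal policy is globally optimal over horizon n. -/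
/-- The state trajectory induced by following action sequence `a` from state `s`:
`s₀ = s` and `s_{t+1} = T s_t a_t`. -/
def st {S A : Type*} (T : S → A → S) (s : S) (a : ℕ → A) : ℕ → S
  | 0 => s
  | t + 1 => T (st T s a t) (a t)

/-- Discounted `n`-step return `Ret(s, a) = Σ_{t<n} γ^t r(s_t, a_t)`. -/
noncomputable def Ret {S A : Type*} (T : S → A → S) (r : S → A → ℝ) (γ : ℝ)
    (s : S) (a : ℕ → A) (n : ℕ) : ℝ :=
  ∑ t ∈ Finset.range n, γ ^ t * r (st T s a t) (a t)

/-- Optimal `n`-step value: `V_0^*(s) = 0`,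
`V_{n+1}^*(s) = max_{a ∈ A} ( r(s,a) + γ V_n^*(T(s,a)) )`. -/
noncomputable def Vstar {S A : Type*} [Fintype A] [Nonempty A]
    (T : S → A → S) (r : S → A → ℝ) (γ : ℝ) : ℕ → S → ℝ
  | 0, _ => 0
  | n + 1, s =>
    Finset.univ.sup' Finset.univ_nonempty fun a => r s a + γ * Vstar T r γ n (T s a)

/-- The state trajectory obtained by following the nonstationary policy
`π = (π₀, π₁, …)` from state `s`: `s₀ = s`, `s_{k+1} = T s_k (π_k s_k)`. -/
def follow {S A : Type*} (T : S → A → S) (π : ℕ → S → A) (s : S) : ℕ → S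
  | 0 => s
  | k + 1 => T (follow T π s k) (π k (follow T π s k))

theorem st_policy_eq_follow {S A : Type*} (T : S → A → S) (π : ℕ → S → A) (s : S) (t : ℕ) :
    st T s (fun k => π k (follow T π s k)) t = follow T π s t := by
  induction t with
  | zero => rfl
  | succ t ih => simp only [st, follow, ih]

/-- A maximizing action attains the maximum in the Bellman recursion. -/
theorem Vstar_succ_eq_of_forall_le {S A : Type*} [Fintype A] [Nonempty A]
    (T : S → A → S) (r : S → A → ℝ) (γ : ℝ) (n : ℕ) (s : S) (b : A)
    (hb : ∀ a, r s a + γ * Vstar T r γ n (T s a) ≤ r s b + γ * Vstar T r γ n (T s b)) :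
    Vstar T r γ (n + 1) s = r s b + γ * Vstar T r γ n (T s b) := by
  rw [Vstar]
  exact le_antisymm (Finset.sup'_le _ _ fun a _ => hb a)
    (Finset.le_sup' (fun a => r s a + γ * Vstar T r γ n (T s a)) (Finset.mem_univ b))

/-- A recursively greedy nonstationary policy is globally optimal over horizon `n`:
if for every `k < n` and every state `s` the action `π_k(s)` maximizes
`a ↦ r(s,a) + γ V_{n−k−1}^*(T(s,a))`, then following `π` from any initial state `s₀`
(taking `a_k = π_k(s_k)`) yields discounted return `Ret(s₀, a) = V_n^*(s₀)`. -/
theorem greedy_policy_is_optimal {S A : Type*} [Fintype S] [Nonempty S] [Fintype A] [Nonempty A]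
    (T : S → A → S) (r : S → A → ℝ) (γ : ℝ) (hγ0 : 0 ≤ γ) (hγ1 : γ ≤ 1)
    (n : ℕ) (π : ℕ → S → A)
    (hgreedy : ∀ k, k < n → ∀ s : S, ∀ a : A,
      r s a + γ * Vstar T r γ (n - k - 1) (T s a) ≤
        r s (π k s) + γ * Vstar T r γ (n - k - 1) (T s (π k s)))
    (s₀ : S) :
    Ret T r γ s₀ (fun k => π k (follow T π s₀ k)) n = Vstar T r γ n s₀ := by
  have partial_return : ∀ m ≤ n,
      Ret T r γ s₀ (fun k => π k (follow T π s₀ k)) m +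
        γ ^ m * Vstar T r γ (n - m) (follow T π s₀ m) = Vstar T r γ n s₀ := by
    intro m
    induction m with
    | zero => simp [Ret, follow]
    | succ m ih =>
      intro hm
      have bellman := Vstar_succ_eq_of_forall_le T r γ (n - m - 1) (follow T π s₀ m) _
        (hgreedy m hm (follow T π s₀ m))
      rw [Nat.sub_add_cancel (by omega : 1 ≤ n - m)] at bellman
      rw [← ih (by omega), bellman, Ret, Finset.sum_range_succ, ← Ret, st_policy_eq_follow,
        follow, ← Nat.sub_sub]
      ring
  simpa [Vstar] using partial_return n le_rfl
end

section
/- For a finite stochastic MDP, the Bellman-defined optimal values upper-bound every policy: for every horizon n, every nonstationary policy π = (σ₁,…,σ_n) (where σ_k : S → A is the decision rule used with k steps remaining), and every state s, the expected discounted return V_n^π(s) satisfies V_n^π(s) ≤ V_n^*(s). -/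
/-- Expected discounted return of a nonstationary policy with decision rules
`σ_k : S → A` (used with `k` steps remaining): `V_0^π(s) = 0` and
`V_{k+1}^π(s) = r(s, σ_{k+1}(s)) + γ Σ_{s'∈S} P(s, σ_{k+1}(s))(s') · V_k^π(s')`. -/
noncomputable def Vpol {S A : Type*} [Fintype S]
    (P : S → A → PMF S) (r : S → A → ℝ) (γ : ℝ) (σ : ℕ → S → A) : ℕ → S → ℝ
  | 0, _ => 0
  | k + 1, s =>
    r s (σ (k + 1) s) +
      γ * ∑ s' : S, (P s (σ (k + 1) s) s').toReal * Vpol P r γ σ k s'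

/-- Optimal values of a finite stochastic MDP: `V_0^*(s) = 0` and
`V_{k+1}^*(s) = max_{a∈A} ( r(s,a) + γ Σ_{s'∈S} P(s,a)(s') · V_k^*(s') )`. -/
noncomputable def VstarS {S A : Type*} [Fintype S] [Fintype A] [Nonempty A]
    (P : S → A → PMF S) (r : S → A → ℝ) (γ : ℝ) : ℕ → S → ℝ
  | 0, _ => 0
  | k + 1, s =>
    Finset.univ.sup' Finset.univ_nonempty fun a =>
      r s a + γ * ∑ s' : S, (P s a s').toReal * VstarS P r γ k s'

/-- For a finite stochastic MDP with discount `0 ≤ γ ≤ 1`, the Bellman-defined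
optimal values upper-bound every policy: for every horizon `n`, every nonstationary
policy `π = (σ₁,…,σ_n)`, and every state `s`, `V_n^π(s) ≤ V_n^*(s)`. -/
theorem policy_value_le_optimal {S A : Type*} [Fintype S] [Nonempty S]
    [Fintype A] [Nonempty A]
    (P : S → A → PMF S) (r : S → A → ℝ) (γ : ℝ) (hγ0 : 0 ≤ γ) (hγ1 : γ ≤ 1)
    (n : ℕ) (σ : ℕ → S → A) (s : S) :
    Vpol P r γ σ n s ≤ VstarS P r γ n s := by
  induction n generalizing s with
  | zero => simp [Vpol, VstarS]
  | succ k ih =>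
    rw [Vpol, VstarS]
    calc
      _ ≤ r s (σ (k + 1) s) +
          γ * ∑ s' : S, (P s (σ (k + 1) s) s').toReal * VstarS P r γ k s' := by
        gcongr with s' _
        exact ih s'
      _ ≤ _ := Finset.le_sup' (fun a => r s a + γ * ∑ s' : S, (P s a s').toReal * VstarS P r γ k s')
        (Finset.mem_univ (σ (k + 1) s))
end

section
/- Infinite-horizon Bellman optimality (deterministic case): for a deterministic MDP with finite nonempty S and A and discount 0 ≤ γ < 1, the value of a stationary policy π : S → A, V^π(s) = Σ_{t=0}^{∞} γ^t r(s_t, π(s_t)) with s₀ = s and s_{t+1} = T(s_t, π(s_t)), is a convergent series; the unique fixed point V^* of the operator (𝒯V)(s) = max_{a∈A} ( r(s,a) + γ V(T(s,a)) ) satisfies V^π(s) ≤ V^*(s) for every stationary policy π and every state s; and any stationary policy π that is greedy with respect to V^*, i.e. π(s) maximizes a ↦ r(s,a) + γ V^*(T(s,a)) for every s, satisfies V^π = V^*. -/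
/-- The trajectory obtained by following the stationary policy `π : S → A` from
state `s`: `s₀ = s`, `s_{t+1} = T s_t (π s_t)`. -/
def straj {S A : Type*} (T : S → A → S) (π : S → A) (s : S) : ℕ → S
  | 0 => s
  | t + 1 => T (straj T π s t) (π (straj T π s t))

/-- Infinite-horizon value of a stationary policy:
`V^π(s) = Σ_{t=0}^{∞} γ^t r(s_t, π(s_t))`. -/
noncomputable def Vpi {S A : Type*} (T : S → A → S) (r : S → A → ℝ) (γ : ℝ)
    (π : S → A) (s : S) : ℝ :=
  ∑' t : ℕ, γ ^ t * r (straj T π s t) (π (straj T π s t))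

/-- The Bellman optimality operator of a deterministic MDP:
`(𝒯V)(s) = max_{a∈A} ( r(s,a) + γ V(T(s,a)) )`. -/
noncomputable def bellmanDet {S A : Type*} [Fintype A] [Nonempty A]
    (T : S → A → S) (r : S → A → ℝ) (γ : ℝ) (V : S → ℝ) : S → ℝ :=
  fun s => Finset.univ.sup' Finset.univ_nonempty fun a => r s a + γ * V (T s a)

section Discounted

variable {S A : Type*}

/-- A bounded reward stream over a finite state space is summable after discounting. -/
lemma summable_discounted [Finite S] {γ : ℝ} (hγ0 : 0 ≤ γ) (hγ1 : γ < 1)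
    (f : S → ℝ) (x : ℕ → S) : Summable fun t : ℕ => γ ^ t * f (x t) := by
  obtain ⟨C, hC⟩ := (Set.finite_range fun s => ‖f s‖).bddAbove
  refine Summable.of_norm_bounded ((summable_geometric_of_lt_one hγ0 hγ1).mul_right C) fun t => ?_
  rw [norm_mul, Real.norm_of_nonneg (pow_nonneg hγ0 t)]
  exact mul_le_mul_of_nonneg_left (hC ⟨x t, rfl⟩) (pow_nonneg hγ0 t)

/-- The discounted one-step differences of a function along a sequence telescope. -/
lemma hasSum_discounted_sub [Finite S] {γ : ℝ} (hγ0 : 0 ≤ γ) (hγ1 : γ < 1)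
    (V : S → ℝ) (x : ℕ → S) :
    HasSum (fun t : ℕ => γ ^ t * (V (x t) - γ * V (x (t + 1)))) (V (x 0)) := by
  have hs := summable_discounted hγ0 hγ1 V x
  have h := hs.hasSum.sub ((summable_nat_add_iff 1).2 hs).hasSum
  rw [hs.tsum_eq_zero_add, pow_zero, one_mul, add_sub_cancel_right] at h
  exact h.congr_fun fun t => by ring

/-- The Bellman operator increases by at most `γ` times the sup distance. -/
lemma bellmanDet_le_add_dist [Fintype S] [Fintype A] [Nonempty A]
    (T : S → A → S) (r : S → A → ℝ) {γ : ℝ} (hγ0 : 0 ≤ γ) (V W : S → ℝ) (s : S) :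
    bellmanDet T r γ V s ≤ bellmanDet T r γ W s + γ * dist V W := by
  refine Finset.sup'_le _ _ fun a _ => ?_
  have hW : r s a + γ * W (T s a) ≤ bellmanDet T r γ W s :=
    Finset.le_sup' (fun a => r s a + γ * W (T s a)) (Finset.mem_univ a)
  have hd : V (T s a) - W (T s a) ≤ dist V W :=
    (le_abs_self _).trans (dist_le_pi_dist V W (T s a))
  linarith [mul_le_mul_of_nonneg_left hd hγ0]

/-- The Bellman operator is a `γ`-contraction in the sup distance. -/
lemma contractingWith_bellmanDet [Fintype S] [Fintype A] [Nonempty A]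
    (T : S → A → S) (r : S → A → ℝ) {γ : ℝ} (hγ0 : 0 ≤ γ) (hγ1 : γ < 1) :
    ContractingWith ⟨γ, hγ0⟩ (bellmanDet T r γ) := by
  refine ⟨hγ1, LipschitzWith.of_dist_le_mul fun V W => ?_⟩
  refine (dist_pi_le_iff (by positivity)).2 fun s => ?_
  have hVW := bellmanDet_le_add_dist T r hγ0 V W s
  have hWV := bellmanDet_le_add_dist T r hγ0 W V s
  rw [dist_comm W V] at hWV
  change |_| ≤ γ * _
  exact abs_le.2 ⟨by linarith, by linarith⟩

end Discounted

/-- Infinite-horizon Bellman optimality for a deterministic MDP with finite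
nonempty `S`, `A` and discount `0 ≤ γ < 1`:
(1) the series defining the value `V^π(s)` of any stationary policy converges;
(2) the operator `𝒯` has a unique fixed point `V^*`;
(3) every fixed point `V^*` of `𝒯` satisfies `V^π(s) ≤ V^*(s)` for every stationary
policy `π` and state `s`, and any stationary policy `π` greedy with respect to
`V^*` (i.e. `π(s)` maximizes `a ↦ r(s,a) + γ V^*(T(s,a))` for every `s`)
satisfies `V^π = V^*`. -/
theorem infinite_horizon_bellman_optimality {S A : Type*}
    [Fintype S] [Nonempty S] [Fintype A] [Nonempty A]
    (T : S → A → S) (r : S → A → ℝ) (γ : ℝ) (hγ0 : 0 ≤ γ) (hγ1 : γ < 1) :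
    (∀ π : S → A, ∀ s : S,
      Summable fun t : ℕ => γ ^ t * r (straj T π s t) (π (straj T π s t))) ∧
    (∃! Vstar : S → ℝ, bellmanDet T r γ Vstar = Vstar) ∧
    (∀ Vstar : S → ℝ, bellmanDet T r γ Vstar = Vstar →
      (∀ π : S → A, ∀ s : S, Vpi T r γ π s ≤ Vstar s) ∧
      (∀ π : S → A,
        (∀ s : S, ∀ a : A,
          r s a + γ * Vstar (T s a) ≤ r s (π s) + γ * Vstar (T s (π s))) →
        Vpi T r γ π = Vstar)) := by
  have hsum (π : S → A) (s : S) :=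
    summable_discounted hγ0 hγ1 (fun s => r s (π s)) (straj T π s)
  have hcontr := contractingWith_bellmanDet T r hγ0 hγ1
  refine ⟨hsum, ⟨_, hcontr.fixedPoint_isFixedPt, fun V hV => hcontr.fixedPoint_unique hV⟩,
    fun V hV => ?_⟩
  have hle (s : S) (a : A) : r s a + γ * V (T s a) ≤ V s := by
    conv_rhs => rw [← hV]
    exact Finset.le_sup' (fun a => r s a + γ * V (T s a)) (Finset.mem_univ a)
  have htel (π : S → A) (s : S) := hasSum_discounted_sub hγ0 hγ1 V (straj T π s)
  refine ⟨fun π s => hasSum_le (fun t => ?_) (hsum π s).hasSum (htel π s), fun π hπ => ?_⟩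
  · refine mul_le_mul_of_nonneg_left ?_ (pow_nonneg hγ0 t)
    exact le_sub_iff_add_le.2 (hle _ _)
  · have hgreedy (s : S) : r s (π s) = V s - γ * V (T s (π s)) := by
      refine eq_sub_of_add_eq (le_antisymm (hle _ _) ?_)
      conv_lhs => rw [← hV]
      exact Finset.sup'_le _ _ fun a _ => hπ s a
    funext s
    refine Eq.trans (tsum_congr fun t => ?_) (htel π s).tsum_eq
    rw [hgreedy]
    rfl
end

section
/- Expressivity and global optimality of the hierarchical policy class (deterministic case of the Global Optimality Proposition): for a deterministic MDP with a finite nonempty set G of options such that every primitive action is an option — i.e. for each a ∈ A there is g_a ∈ G with ℓ_{g_a}(s) = [a] for every state s — the following holds for every state s and horizon n: the maximum, over all option sequences (g₁,…,g_m) of any length whose total duration from s is exactly n, of the composed hierarchical return, equals the flat optimal value V_n^*(s); consequently a hierarchical policy that is recursively optimal over such option sequences achieves the same value as the optimal flat policy from s. -/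
/-- The final state of the trajectory induced by applying the actions of the list
`l` in order from `s` via `T`. -/
def traj {S A : Type*} (T : S → A → S) : S → List A → S
  | s, [] => s
  | s, a :: l => traj T (T s a) l

/-- Discounted return of the action list `l` from state `s`:
`Ret(s, l) = Σ_{t < length l} γ^t r(s_t, a_t)`. -/
noncomputable def RetL {S A : Type*} (T : S → A → S) (r : S → A → ℝ) (γ : ℝ)
    (s : S) (l : List A) : ℝ :=
  ∑ t : Fin l.length, γ ^ (t : ℕ) * r (traj T s (l.take t)) (l.get t)

/-- Composed hierarchical return `Σ_{i=1}^{m} γ^{D_{i−1}} R_{g_i}(u_{i−1})` of a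
sequence of options executed from `s`. -/
noncomputable def hret {S A : Type*} (T : S → A → S) (r : S → A → ℝ) (γ : ℝ) :
    S → List (S → List A) → ℝ
  | _, [] => 0
  | s, g :: gs =>
    RetL T r γ s (g s) + γ ^ (g s).length * hret T r γ (traj T s (g s)) gs

/-- Total duration `Σ_i τ_{g_i}(u_{i−1})` of executing a sequence of options from
`s`. -/
def totalDur {S A : Type*} (T : S → A → S) : S → List (S → List A) → ℕ
  | _, [] => 0
  | s, g :: gs => (g s).length + totalDur T (traj T s (g s)) gs

theorem RetL_nil {S A : Type*} (T : S → A → S) (r : S → A → ℝ) (γ : ℝ) (s : S) :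
    RetL T r γ s [] = 0 := by
  simp [RetL]

theorem RetL_cons {S A : Type*} (T : S → A → S) (r : S → A → ℝ) (γ : ℝ) (s : S)
    (a : A) (l : List A) :
    RetL T r γ s (a :: l) = r s a + γ * RetL T r γ (T s a) l := by
  unfold RetL
  rw [Finset.mul_sum]
  refine (Fin.sum_univ_succ (n := l.length) _).trans ?_
  simp [traj, pow_succ', mul_assoc]

/-- Following the actions of `l` and then acting optimally for `k` steps is no better than
acting optimally from the start. -/
theorem RetL_add_Vstar_le {S A : Type*} [Fintype A] [Nonempty A]
    (T : S → A → S) (r : S → A → ℝ) {γ : ℝ} (hγ : 0 ≤ γ) (k : ℕ) (l : List A) (s : S) :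
    RetL T r γ s l + γ ^ l.length * Vstar T r γ k (traj T s l) ≤
      Vstar T r γ (l.length + k) s := by
  induction l generalizing s with
  | nil => simp [RetL_nil, traj]
  | cons a l ih =>
    have hlen : (a :: l).length + k = (l.length + k) + 1 := by
      rw [List.length_cons]; omega
    rw [hlen, RetL_cons]
    calc r s a + γ * RetL T r γ (T s a) l +
          γ ^ (a :: l).length * Vstar T r γ k (traj T s (a :: l))
        = r s a + γ * (RetL T r γ (T s a) l +
            γ ^ l.length * Vstar T r γ k (traj T (T s a) l)) := by
          rw [List.length_cons, traj]; ring
      _ ≤ r s a + γ * Vstar T r γ (l.length + k) (T s a) := by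
          gcongr
          exact ih (T s a)
      _ ≤ Vstar T r γ ((l.length + k) + 1) s :=
          Finset.le_sup' (fun a => r s a + γ * Vstar T r γ (l.length + k) (T s a))
            (Finset.mem_univ a)

theorem hret_le_Vstar_totalDur {S A : Type*} [Fintype A] [Nonempty A]
    (T : S → A → S) (r : S → A → ℝ) {γ : ℝ} (hγ : 0 ≤ γ) (gs : List (S → List A)) (s : S) :
    hret T r γ s gs ≤ Vstar T r γ (totalDur T s gs) s := by
  induction gs generalizing s with
  | nil => simp [hret, totalDur, Vstar]
  | cons g gs ih =>
    rw [hret, totalDur]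
    refine le_trans ?_ (RetL_add_Vstar_le T r hγ _ (g s) s)
    gcongr
    exact ih _

theorem exists_hret_eq_Vstar {S A G : Type*} [Fintype A] [Nonempty A]
    (T : S → A → S) (r : S → A → ℝ) (γ : ℝ) (ℓ : G → S → List A)
    (hprim : ∀ a : A, ∃ g : G, ∀ s : S, ℓ g s = [a]) (n : ℕ) (s : S) :
    ∃ gs : List G,
      totalDur T s (gs.map ℓ) = n ∧ Vstar T r γ n s = hret T r γ s (gs.map ℓ) := by
  induction n generalizing s with
  | zero => exact ⟨[], rfl, rfl⟩
  | succ n ih =>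
    obtain ⟨a, -, ha⟩ := Finset.exists_mem_eq_sup' Finset.univ_nonempty
      fun a => r s a + γ * Vstar T r γ n (T s a)
    obtain ⟨g, hg⟩ := hprim a
    obtain ⟨gs, hdur, hret_eq⟩ := ih (T s a)
    refine ⟨g :: gs, ?_, ?_⟩
    · simp [totalDur, hg, traj, hdur, add_comm]
    · rw [Vstar, ha]
      simp [hret, hg, traj, RetL_cons, RetL_nil, hret_eq]

/-- Expressivity and global optimality of the hierarchical policy class
(deterministic case): if every primitive action is available as an option
(for each `a ∈ A` there is `g_a ∈ G` with `ℓ_{g_a}(s) = [a]` for every `s`), then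
for every state `s` and horizon `n`, the maximum over all option sequences
`(g₁,…,g_m)` of any length whose total duration from `s` is exactly `n` of the
composed hierarchical return equals the flat optimal value `V_n^*(s)`; hence a
hierarchical policy that is recursively optimal over such option sequences
achieves the value of the optimal flat policy from `s`. -/
theorem hierarchical_max_eq_flat_optimal {S A G : Type*}
    [Fintype S] [Nonempty S] [Fintype A] [Nonempty A] [Fintype G] [Nonempty G]
    (T : S → A → S) (r : S → A → ℝ) (γ : ℝ) (hγ0 : 0 ≤ γ) (hγ1 : γ ≤ 1)
    (ℓ : G → S → List A) (hne : ∀ g : G, ∀ s : S, ℓ g s ≠ [])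
    (hprim : ∀ a : A, ∃ g : G, ∀ s : S, ℓ g s = [a])
    (s : S) (n : ℕ) :
    IsGreatest
      {x : ℝ | ∃ gs : List G,
        totalDur T s (gs.map ℓ) = n ∧ x = hret T r γ s (gs.map ℓ)}
      (Vstar T r γ n s) := by
  refine ⟨exists_hret_eq_Vstar T r γ ℓ hprim n s, ?_⟩
  rintro x ⟨gs, rfl, rfl⟩
  exact hret_le_Vstar_totalDur T r hγ0 (gs.map ℓ) s
end
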